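/- Let M(z) = Σ_{n≥0} C(3n,n)/(n+1) · zⁿ (convergent for |z| < 4/27) and R(z) = (4z − 1 + √(1−2z))/(2(1−2z)). Then there exists ε > 0 such that for all real z with |z| < ε, R(z·M(z)) + 1 = M(z). -/

import Mathlib

/-- The moment generating function of `μ₀`, whose moments are `C(3n,n)/(n+1)`. -/
noncomputable def M (z : ℝ) : ℝ :=
  ∑' n : ℕ, (Nat.choose (3 * n) n : ℝ) / (n + 1) * z ^ n

/-- The R-transform of `μ₀`. -/
noncomputable def R (z : ℝ) : ℝ :=
  (4 * z - 1 + Real.sqrt (1 - 2 * z)) / (2 * (1 - 2 * z))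

open Finset Polynomial in
theorem aux_poly (k : ℕ) :
    ∑ N ∈ range (k + 4), (-1 : ℝ) ^ (k + 3 - N) * ((k + 3).choose N : ℝ) *
      (6 * (N : ℝ) * (2 * N + 1) * ∏ j ∈ range k, (2 * (N : ℝ) + (3 + j))) = 0 := by
  let P : ℝ[X] := C 6 * X * (C 2 * X + C 1) * ∏ j ∈ range k, (C 2 * X + C (3 + (j : ℝ)))
  have hlin : ∀ b : ℝ, (C 2 * X + C b : ℝ[X]).natDegree ≤ 1 := fun b => natDegree_linear_le
  have hprod : (∏ j ∈ range k, (C 2 * X + C (3 + (j : ℝ)) : ℝ[X])).natDegree ≤ k := by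
    refine (natDegree_prod_le _ _).trans ?_
    refine (Finset.sum_le_sum (g := fun _ => 1) fun (j : ℕ) _ => hlin (3 + (j : ℝ))).trans ?_
    simp
  have hP : P.natDegree < k + 3 := by
    have h1 : (C 6 * X : ℝ[X]).natDegree ≤ 1 := by simp
    have h2 := natDegree_mul_le_of_le (natDegree_mul_le_of_le h1 (hlin 1)) hprod
    exact lt_of_le_of_lt h2 (by omega)
  have h := congr_fun (Polynomial.fwdDiff_iter_eq_zero_of_degree_lt hP) 0
  rw [fwdDiff_iter_eq_sum_shift] at h
  simp only [Pi.zero_apply] at h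
  rw [← h]
  refine Finset.sum_congr rfl fun N _ => ?_
  simp [P, eval_prod]

open Finset Nat in
theorem aux_term (k n l : ℕ) (h : n + l = k + 2) :
    ((3 * (n + 1)).choose (n + 1) : ℝ) / ((n + 1 : ℕ) + 1) * ((l + (3 * n + 2)).choose (3 * n + 2) : ℝ)
      = ((k + 3).choose (n + 1) : ℝ) *
        (6 * ((n + 1 : ℕ) : ℝ) * (2 * ((n + 1 : ℕ) : ℝ) + 1) *
          ∏ j ∈ range k, (2 * ((n + 1 : ℕ) : ℝ) + (3 + j))) / (k + 3)! := by
  have e1 : ((3 * (n + 1)).choose (n + 1) : ℝ) = (3 * n + 3)! / ((n + 1)! * (2 * n + 2)!) := by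
    have := Nat.cast_add_choose ℝ (a := n + 1) (b := 2 * n + 2)
    rw [show n + 1 + (2 * n + 2) = 3 * n + 3 by ring] at this
    rw [← this]; rfl
  have e2 : ((l + (3 * n + 2)).choose (3 * n + 2) : ℝ) = (3 * n + 2 + l)! / ((3 * n + 2)! * l !) := by
    rw [← Nat.cast_add_choose, add_comm]
  have e3 : ((k + 3).choose (n + 1) : ℝ) = (k + 3)! / ((n + 1)! * l !) := by
    have := Nat.cast_add_choose ℝ (a := n + 1) (b := l)
    rw [show n + 1 + l = k + 3 by omega] at this
    exact this
  have e4 : ((2 * n + 4)! : ℝ) * ∏ j ∈ range k, (2 * ((n + 1 : ℕ) : ℝ) + (3 + j))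
      = (3 * n + 2 + l)! := by
    rw [show 3 * n + 2 + l = 2 * n + 4 + k by omega, ← Nat.factorial_mul_ascFactorial (2 * n + 4) k,
      Nat.ascFactorial_eq_prod_range]
    push_cast
    congr 1
    apply Finset.prod_congr rfl
    intro j _
    ring
  have e5 : ((2 * n + 4)! : ℝ) = (2 * n + 4) * (2 * n + 3) * (2 * n + 2)! := by
    rw [show 2 * n + 4 = (2 * n + 2) + 1 + 1 by ring, Nat.factorial_succ, Nat.factorial_succ]
    push_cast; ring
  have e6 : ((3 * n + 3)! : ℝ) = (3 * n + 3) * (3 * n + 2)! := by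
    rw [show 3 * n + 3 = (3 * n + 2) + 1 by ring, Nat.factorial_succ]
    push_cast; ring
  rw [e1, e2, e3, ← e4, e5, e6]
  have p1 : ((2 * n + 2)! : ℝ) ≠ 0 := by positivity
  have p2 : ((3 * n + 2)! : ℝ) ≠ 0 := by positivity
  have p3 : ((n + 1)! : ℝ) ≠ 0 := by positivity
  have p4 : (l ! : ℝ) ≠ 0 := by positivity
  have p5 : ((k + 3)! : ℝ) ≠ 0 := by positivity
  generalize ∏ j ∈ range k, (2 * ((n + 1 : ℕ) : ℝ) + (3 + j)) = Q
  push_cast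
  have p6 : (n : ℝ) + 1 + 1 ≠ 0 := by positivity
  field_simp
  ring

open Finset in
theorem aux_diag (k : ℕ) :
    ∑ p ∈ antidiagonal (k + 2), (-1 : ℝ) ^ p.2 *
      (((3 * (p.1 + 1)).choose (p.1 + 1) : ℝ) / ((p.1 + 1 : ℕ) + 1) *
        ((p.2 + (3 * p.1 + 2)).choose (3 * p.1 + 2) : ℝ)) = 0 := by
  have h := aux_poly k
  rw [Finset.sum_range_succ'] at h
  simp only [Nat.cast_zero, mul_zero, zero_mul, add_zero] at h
  rw [Finset.sum_congr rfl (fun p hp => by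
    rw [aux_term k p.1 p.2 (mem_antidiagonal.1 hp)])]
  rw [Finset.Nat.sum_antidiagonal_eq_sum_range_succ_mk]
  rw [← zero_div ((k + 3).factorial : ℝ), ← h, Finset.sum_div]
  refine Finset.sum_congr rfl fun n _ => ?_
  rw [show k + 3 - (n + 1) = k + 2 - n by omega]
  ring

theorem aux_c_le (n : ℕ) : ((3 * n).choose n : ℝ) / ((n : ℝ) + 1) ≤ 8 ^ n := by
  have h1 : ((3 * n).choose n : ℝ) ≤ 8 ^ n := by
    have := Nat.choose_le_two_pow (3 * n) n
    rw [pow_mul] at this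
    exact_mod_cast this
  exact (div_le_self (by positivity) (by linarith [(Nat.cast_nonneg n : (0 : ℝ) ≤ n)])).trans h1

/-- The double series. -/
noncomputable def auxF (w : ℝ) (p : ℕ × ℕ) : ℝ :=
  ((3 * (p.1 + 1)).choose (p.1 + 1) : ℝ) / ((p.1 + 1 : ℕ) + 1) * w ^ (p.1 + 1) *
    (((p.2 + (3 * p.1 + 2)).choose (3 * p.1 + 2) : ℝ) * (-w) ^ p.2)

theorem auxF_row (w : ℝ) (hw : |w| < 1) (n : ℕ) : HasSum (fun k => auxF w (n, k))
    (((3 * (n + 1)).choose (n + 1) : ℝ) / ((n + 1 : ℕ) + 1) * (w / (1 + w) ^ 3) ^ (n + 1)) := by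
  have h := (hasSum_choose_mul_geometric_of_norm_lt_one (𝕜 := ℝ) (3 * n + 2) (r := -w)
    (by simpa using hw)).mul_left
    (((3 * (n + 1)).choose (n + 1) : ℝ) / ((n + 1 : ℕ) + 1) * w ^ (n + 1))
  convert! h using 1
  rw [div_pow, ← pow_mul, show 3 * (n + 1) = 3 * n + 2 + 1 by ring, sub_neg_eq_add]
  ring

theorem auxF_row_abs (w : ℝ) (hw : |w| < 1) (n : ℕ) : HasSum (fun k => ‖auxF w (n, k)‖)
    (((3 * (n + 1)).choose (n + 1) : ℝ) / ((n + 1 : ℕ) + 1) * (|w| / (1 - |w|) ^ 3) ^ (n + 1)) := by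
  have h := (hasSum_choose_mul_geometric_of_norm_lt_one (𝕜 := ℝ) (3 * n + 2) (r := |w|)
    (by simpa using hw)).mul_left
    (((3 * (n + 1)).choose (n + 1) : ℝ) / ((n + 1 : ℕ) + 1) * |w| ^ (n + 1))
  convert! h using 1
  · funext k
    have p : (0 : ℝ) ≤ ((n + 1 : ℕ) : ℝ) + 1 := by positivity
    simp only [auxF, Real.norm_eq_abs, abs_mul, abs_pow, abs_div, abs_neg, Nat.abs_cast,
      abs_of_nonneg p]
  · rw [div_pow, ← pow_mul, show 3 * (n + 1) = 3 * n + 2 + 1 by ring]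
    ring

theorem aux_geom (x : ℝ) (hx : |x| ≤ 1 / 16) :
    Summable (fun n : ℕ => ((3 * n).choose n : ℝ) / ((n : ℝ) + 1) * x ^ n) := by
  refine Summable.of_norm_bounded (g := fun n : ℕ => (1 / 2 : ℝ) ^ n)
    (summable_geometric_of_lt_one (by norm_num) (by norm_num)) fun n => ?_
  have p : (0 : ℝ) ≤ ((3 * n).choose n : ℝ) / ((n : ℝ) + 1) := by positivity
  rw [norm_mul, norm_pow, Real.norm_eq_abs, Real.norm_eq_abs, abs_of_nonneg p]
  calc _ ≤ (8 : ℝ) ^ n * (1 / 16) ^ n := by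
        gcongr
        exact aux_c_le n
    _ = (1 / 2) ^ n := by rw [← mul_pow]; norm_num

theorem auxF_summable (w : ℝ) (hw : |w| ≤ 1 / 100) : Summable (auxF w) := by
  have hw1 : |w| < 1 := by linarith
  refine Summable.of_norm ?_
  rw [summable_prod_of_nonneg (fun _ => norm_nonneg _)]
  refine ⟨fun n => (auxF_row_abs w hw1 n).summable, ?_⟩
  simp only [(auxF_row_abs w hw1 _).tsum_eq]
  have hx : |(|w| / (1 - |w|) ^ 3)| ≤ 1 / 16 := by
    have h3 : (99 / 100 : ℝ) ^ 3 ≤ (1 - |w|) ^ 3 := by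
      gcongr
      linarith
    rw [abs_of_nonneg (by positivity), div_le_iff₀ (by positivity)]
    linarith
  exact (summable_nat_add_iff 1).2 (aux_geom _ hx)

open Finset in
theorem aux_M (w : ℝ) (hw : |w| ≤ 1 / 100) :
    M (w / (1 + w) ^ 3) = (1 + w) * (2 + w) / 2 := by
  have hw1 : |w| < 1 := by linarith
  have hb := abs_le.1 hw
  have hx : |w / (1 + w) ^ 3| ≤ 1 / 16 := by
    have h3 : (99 / 100 : ℝ) ^ 3 ≤ (1 + w) ^ 3 := by
      gcongr
      linarith
    rw [abs_div, abs_of_nonneg (show (0 : ℝ) ≤ (1 + w) ^ 3 by positivity),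
      div_le_iff₀ (by positivity)]
    linarith
  have hF := auxF_summable w hw
  unfold M
  rw [(aux_geom _ hx).tsum_eq_zero_add]
  have e1 : ∑' n : ℕ, (((3 * (n + 1)).choose (n + 1) : ℝ) / ((n + 1 : ℕ) + 1)
      * (w / (1 + w) ^ 3) ^ (n + 1)) = ∑' p, auxF w p := by
    rw [hF.tsum_prod]
    exact tsum_congr fun n => (auxF_row w hw1 n).tsum_eq.symm
  rw [e1, ← HasAntidiagonal.sigmaAntidiagonalEquivProd.tsum_eq (auxF w)]
  have hS : Summable (fun c : (Σ n : ℕ, antidiagonal n) =>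
      auxF w (HasAntidiagonal.sigmaAntidiagonalEquivProd c)) :=
    HasAntidiagonal.sigmaAntidiagonalEquivProd.summable_iff.2 hF
  rw [hS.tsum_sigma' (fun n ↦ (hasSum_fintype _).summable)]
  have e2 : ∀ m : ℕ, ∑' c : antidiagonal m,
      auxF w (HasAntidiagonal.sigmaAntidiagonalEquivProd ⟨m, c⟩)
      = w ^ (m + 1) * ∑ p ∈ antidiagonal m, (-1 : ℝ) ^ p.2 *
      (((3 * (p.1 + 1)).choose (p.1 + 1) : ℝ) / ((p.1 + 1 : ℕ) + 1) *
        ((p.2 + (3 * p.1 + 2)).choose (3 * p.1 + 2) : ℝ)) := by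
    intro m
    rw [tsum_fintype]
    simp only [HasAntidiagonal.sigmaAntidiagonalEquivProd_apply]
    rw [Finset.sum_coe_sort (antidiagonal m) (fun p => auxF w p), Finset.mul_sum]
    refine Finset.sum_congr rfl fun p hp => ?_
    rw [← mem_antidiagonal.1 hp, auxF, neg_pow w]
    ring
  simp only [e2]
  rw [tsum_eq_sum (s := range 2)]
  · simp [Finset.sum_range_succ, Finset.Nat.antidiagonal_succ, Nat.choose]
    ring
  · intro m hm
    obtain ⟨k, rfl⟩ : ∃ k, m = k + 2 := ⟨m - 2, by simp at hm; omega⟩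
    rw [aux_diag, mul_zero]

theorem stmt_15 :
    ∃ ε > (0 : ℝ), ∀ z : ℝ, |z| < ε → R (z * M z) + 1 = M z := by
  refine ⟨1 / 1000, by norm_num, fun z hz => ?_⟩
  have hz' := abs_lt.1 hz
  obtain ⟨w, hw, hw0⟩ : ∃ w ∈ Set.Icc (-(1 / 100) : ℝ) (1 / 100), w - z * (1 + w) ^ 3 = 0 := by
    have hc : ContinuousOn (fun w : ℝ => w - z * (1 + w) ^ 3) (Set.Icc (-(1 / 100)) (1 / 100)) := by
      fun_prop
    exact intermediate_value_Icc (by norm_num) hc ⟨by norm_num; linarith, by norm_num; linarith⟩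
  have hpos : 0 < 1 + w := by linarith [hw.1]
  have hzw : z = w / (1 + w) ^ 3 := by
    rw [eq_div_iff (by positivity)]; linarith
  have hM : M z = (1 + w) * (2 + w) / 2 := by
    rw [hzw]; exact aux_M w (abs_le.2 hw)
  have hs : 1 - 2 * (z * M z) = (1 / (1 + w)) ^ 2 := by
    rw [hM, hzw]; field_simp; ring
  have h4 : 4 * (z * M z) - 1 = 1 - 2 * (1 / (1 + w)) ^ 2 := by rw [← hs]; ring
  rw [R, hs, h4, Real.sqrt_sq (by positivity), hM]
  field_simp
  ring
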